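/- Let y ∈ ℝ⁴_{>0}, N = y1+y2+y3+y4, and set z1 = y1+y2+2y3+2y4, z2 = y1+3y3+2y4, z3 = y1+3y2+2y4, z4 = y1+2y2+y3+2y4. Define r = (2z2z3/(3z1z4), 4z3³/(27z1z4²), 4z2³/(27z1²z4), z2²z3²/(27z1²z4²)). Then r1 + 3r3 + 2r4 = γ·z2/N and r1 + 3r2 + 2r4 = γ·z3/N for a common factor γ > 0; i.e., (r1+3r3+2r4)·z3 = (r1+3r2+2r4)·z2. -/

import Mathlib

/-- The sufficient statistics of the closed-form vector `r` are proportional to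
those of the data: `(A₁r)·(A₂y) = (A₂r)·(A₁y)`, where `A₁r = r₁+3r₃+2r₄`,
`A₂r = r₁+3r₂+2r₄`, `z₂ = A₁y`, `z₃ = A₂y`. -/
theorem suff_stats_proportional (y1 y2 y3 y4 z1 z2 z3 z4 r1 r2 r3 r4 : ℝ)
    (h1 : 0 < y1) (h2 : 0 < y2) (h3 : 0 < y3) (h4 : 0 < y4)
    (hz1 : z1 = y1 + y2 + 2*y3 + 2*y4)
    (hz2 : z2 = y1 + 3*y3 + 2*y4)
    (hz3 : z3 = y1 + 3*y2 + 2*y4)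
    (hz4 : z4 = y1 + 2*y2 + y3 + 2*y4)
    (hr1 : r1 = 2*z2*z3 / (3*z1*z4))
    (hr2 : r2 = 4*z3^3 / (27*z1*z4^2))
    (hr3 : r3 = 4*z2^3 / (27*z1^2*z4))
    (hr4 : r4 = z2^2*z3^2 / (27*z1^2*z4^2)) :
    (r1 + 3*r3 + 2*r4) * z3 = (r1 + 3*r2 + 2*r4) * z2 := by
  have p1 : z1 ≠ 0 := by rw [hz1]; positivity
  have p4 : z4 ≠ 0 := by rw [hz4]; positivity
  have e1 : y1 + y2 + 2*y3 + 2*y4 = (2*z2 + z3)/3 := by rw [hz2, hz3]; ring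
  have e4 : y1 + 2*y2 + y3 + 2*y4 = (z2 + 2*z3)/3 := by rw [hz2, hz3]; ring
  rw [e1] at hz1
  rw [e4] at hz4
  have k1 : (r1 + 3*r3 + 2*r4) * z3 =
      (18*z2*z3*z1*z4 + 12*z2^3*z4 + 2*z2^2*z3^2) * z3 / (27*z1^2*z4^2) := by
    rw [hr1, hr3, hr4]; field_simp; ring
  have k2 : (r1 + 3*r2 + 2*r4) * z2 =
      (18*z2*z3*z1*z4 + 12*z3^3*z1 + 2*z2^2*z3^2) * z2 / (27*z1^2*z4^2) := by
    rw [hr1, hr2, hr4]; field_simp; ring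
  rw [k1, k2]
  congr 1
  rw [hz1, hz4]
  ring
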